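/- Let K be an imaginary quadratic field, i.e. a field with dim_ℚ K = 2 admitting no ring homomorphism into ℝ. If G is a finite subgroup of the group GL₂(K) of invertible 2×2 matrices over K, then G is solvable and its order equals 2^m·3^n for some non-negative integers m and n. -/

import Mathlib

open Polynomial in
lemma aux_minpoly_degree {K : Type} [Field K] [Algebra ℚ K] (hdim : Module.finrank ℚ K = 2)
    (A : Matrix (Fin 2) (Fin 2) K) :
    ∃ P : ℚ[X], P.Monic ∧ P.natDegree = 4 ∧ aeval A P = 0 := by
  have : FiniteDimensional ℚ K := Module.finite_of_finrank_pos (by omega)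
  let b : Module.Basis (Fin 2) ℚ K := Module.finBasisOfFinrankEq ℚ K hdim
  let φ : Matrix (Fin 2) (Fin 2) K →ₐ[ℚ] Matrix (Fin 2) (Fin 2) (Matrix (Fin 2) (Fin 2) ℚ) :=
    (Algebra.leftMulMatrix b).mapMatrix
  let ψ : Matrix (Fin 2) (Fin 2) (Matrix (Fin 2) (Fin 2) ℚ) →ₐ[ℚ] _ :=
    (Matrix.compAlgEquiv (Fin 2) (Fin 2) ℚ ℚ).toAlgHom
  let f := ψ.comp φ
  have hf : Function.Injective f := by
    have h1 : Function.Injective ψ := (Matrix.compAlgEquiv (Fin 2) (Fin 2) ℚ ℚ).injective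
    have h2 : Function.Injective φ := Matrix.map_injective (Algebra.leftMulMatrix_injective b)
    intro x y hxy
    exact h2 (h1 hxy)
  refine ⟨(f A).charpoly, Matrix.charpoly_monic _, ?_, ?_⟩
  · rw [Matrix.charpoly_natDegree_eq_dim]; simp
  · apply hf
    rw [map_zero, ← aeval_algHom_apply, Matrix.aeval_self_charpoly]

open Polynomial in
lemma aux_cyclo_dvd {A : Type} [Ring A] [Algebra ℚ A] (x : A) (p k : ℕ) (hp : p.Prime)
    (hx : x ^ p ^ (k+1) = 1) (hx' : x ^ p ^ k ≠ 1) (P : ℚ[X]) (hP : aeval x P = 0) :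
    cyclotomic (p ^ (k+1)) ℚ ∣ P := by
  have hirr := cyclotomic.irreducible_rat (n := p ^ (k+1)) (pow_pos hp.pos _)
  by_contra hnd
  obtain ⟨a, b, hab⟩ := (hirr.isCoprime_or_dvd P).resolve_right hnd
  have := Fact.mk hp
  have h := cyclotomic_prime_pow_mul_X_pow_sub_one ℚ p k
  have h2 : X ^ p ^ k - 1 = a * (X ^ p ^ (k+1) - 1) + b * (X ^ p ^ k - 1) * P := by
    rw [← h]
    linear_combination (-(X ^ p ^ k - 1)) * hab
  have h3 := congrArg (aeval x) h2
  simp [hx, hP] at h3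
  exact hx' (sub_eq_zero.mp h3)

open Polynomial in
lemma aux_totient_le {K : Type} [Field K] [Algebra ℚ K] (hdim : Module.finrank ℚ K = 2)
    (A : Matrix (Fin 2) (Fin 2) K) (p k : ℕ) (hp : p.Prime)
    (hx : A ^ p ^ (k+1) = 1) (hx' : A ^ p ^ k ≠ 1) :
    (p ^ (k+1)).totient ≤ 4 := by
  obtain ⟨P, hm, hd, h0⟩ := aux_minpoly_degree hdim A
  have := natDegree_le_of_dvd (aux_cyclo_dvd A p k hp hx hx' P h0) hm.ne_zero
  rwa [natDegree_cyclotomic, hd] at this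

open Polynomial in
lemma aux_totient_le' {K : Type} [Field K] [Algebra ℚ K] (hdim : Module.finrank ℚ K = 2)
    (x : K) (p k : ℕ) (hp : p.Prime)
    (hx : x ^ p ^ (k+1) = 1) (hx' : x ^ p ^ k ≠ 1) :
    (p ^ (k+1)).totient ≤ 2 := by
  have : FiniteDimensional ℚ K := Module.finite_of_finrank_pos (by omega)
  have := natDegree_le_of_dvd (aux_cyclo_dvd x p k hp hx hx' _ (minpoly.aeval ℚ x))
    (minpoly.ne_zero (IsIntegral.of_finite ℚ x))
  rw [natDegree_cyclotomic] at this
  exact this.trans (hdim ▸ minpoly.natDegree_le x)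

open Polynomial in
lemma aux_phi5 {K : Type} [Field K] [Algebra ℚ K] (hdim : Module.finrank ℚ K = 2)
    (A : Matrix (Fin 2) (Fin 2) K) (h5 : A ^ 5 = 1) (h1 : A ≠ 1) :
    1 + A + A ^ 2 + A ^ 3 + A ^ 4 = 0 := by
  obtain ⟨P, hm, hd, h0⟩ := aux_minpoly_degree hdim A
  have h := aux_cyclo_dvd A 5 0 (by norm_num) (by simpa using h5) (by simpa using h1) P h0
  have he : P = cyclotomic (5 ^ (0+1)) ℚ := by
    apply eq_of_monic_of_dvd_of_natDegree_le (cyclotomic.monic _ ℚ) hm h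
    rw [natDegree_cyclotomic, hd]
    decide
  have : Fact (Nat.Prime 5) := ⟨by norm_num⟩
  rw [he, zero_add, pow_one, cyclotomic_prime] at h0
  simpa [Finset.sum_range_succ] using h0

lemma aux_ch {K : Type} [Field K] (A : Matrix (Fin 2) (Fin 2) K) (hd : A.det = 1) :
    A * A = A.trace • A - 1 := by
  rw [Matrix.det_fin_two] at hd
  ext i j
  fin_cases i <;> fin_cases j <;>
    simp [Matrix.mul_apply, Matrix.trace, Fin.sum_univ_two] <;> first | linear_combination -hd | ring

open Polynomial in
lemma aux_no_sqrt5 {K : Type} [Field K] [Algebra ℚ K] (hdim : Module.finrank ℚ K = 2)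
    (hreal : IsEmpty (K →+* ℝ)) (t : K) (ht : t ^ 2 + t - 1 = 0) : False := by
  have : FiniteDimensional ℚ K := Module.finite_of_finrank_pos (by omega)
  have hS := IntermediateField.isSimpleOrder_of_finrank_prime ℚ K (by rw [hdim]; norm_num)
  rcases hS.eq_bot_or_eq_top (IntermediateField.adjoin ℚ {t}) with h | h
  · have : t ∈ (⊥ : IntermediateField ℚ K) := h ▸ IntermediateField.mem_adjoin_simple_self ℚ t
    rw [IntermediateField.mem_bot] at this
    obtain ⟨q, rfl⟩ := this
    have hq : q ^ 2 + q - 1 = 0 := by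
      apply (algebraMap ℚ K).injective
      rw [map_sub, map_add, map_pow, map_one, map_zero]
      exact ht
    have h5 : (2 * q + 1) * (2 * q + 1) = ((5 : ℕ) : ℚ) := by push_cast; linear_combination 4 * hq
    have hi : Irrational √((5:ℕ):ℝ) := Nat.Prime.irrational_sqrt (by norm_num)
    apply hi
    refine ⟨|2 * q + 1|, ?_⟩
    have : ((5 : ℕ) : ℝ) = (2 * (q:ℝ) + 1) * (2 * q + 1) := by exact_mod_cast h5.symm
    rw [this, Real.sqrt_mul_self_eq_abs]
    push_cast
    rfl
  · have hsp : ((minpoly ℚ t).map (algebraMap ℚ ℝ)).Splits := by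
      have hdvd : minpoly ℚ t ∣ (X ^ 2 + X - 1 : ℚ[X]) := minpoly.dvd _ _ (by simpa using ht)
      have hdvd2 := Polynomial.map_dvd (algebraMap ℚ ℝ) hdvd
      have h5 : (√5 : ℝ) * √5 = 5 := Real.mul_self_sqrt (by norm_num)
      have he : (X ^ 2 + X - 1 : ℚ[X]).map (algebraMap ℚ ℝ) =
          (X - C ((-1 + √5) / 2)) * (X - C ((-1 - √5) / 2)) := by
        have h1 : C ((-1 + √5) / 2) + C ((-1 - √5) / 2) = (-1 : ℝ[X]) := by
          rw [← C_add, ← C_1, ← C_neg]; congr 1; ring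
        have h2 : C ((-1 + √5) / 2) * C ((-1 - √5) / 2) = (-1 : ℝ[X]) := by
          rw [← C_mul, ← C_1, ← C_neg]; congr 1; linear_combination (-1/4) * h5
        simp only [Polynomial.map_add, Polynomial.map_sub, Polynomial.map_pow, Polynomial.map_X,
          Polynomial.map_one]
        linear_combination X * h1 - h2
      have hs : ((X - C ((-1 + √5) / 2)) * (X - C ((-1 - √5) / 2)) : ℝ[X]).Splits :=
        (Splits.X_sub_C _).mul (Splits.X_sub_C _)
      refine Splits.of_dvd hs ?_ (he ▸ hdvd2)
      exact mul_ne_zero (X_sub_C_ne_zero _) (X_sub_C_ne_zero _)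
    obtain ⟨φ⟩ := IntermediateField.nonempty_algHom_of_adjoin_splits (F := ℚ) (E := K) (K := ℝ)
      (S := {t}) (by
        rintro s rfl
        exact ⟨IsIntegral.of_finite ℚ _, hsp⟩) h
    exact hreal.false φ.toRingHom

lemma aux_no5 {K : Type} [Field K] [Algebra ℚ K] (hdim : Module.finrank ℚ K = 2)
    (hreal : IsEmpty (K →+* ℝ)) (A : Matrix (Fin 2) (Fin 2) K) (h5 : A ^ 5 = 1) : A = 1 := by
  by_contra h1
  have hphi := aux_phi5 hdim A h5 h1
  have hd : A.det = 1 := by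
    by_contra hne
    have := aux_totient_le' hdim A.det 5 0 (by norm_num)
      (by simp [← Matrix.det_pow, h5]) (by simpa using hne)
    revert this; decide
  have hch := aux_ch A hd
  set t := A.trace with ht
  have e2 : A ^ 2 = t • A - 1 := by rw [pow_two, hch]
  have e3 : A ^ 3 = (t ^ 2 - 1) • A - t • 1 := by
    rw [pow_succ, e2, sub_mul, smul_mul_assoc, hch, one_mul]
    module
  have e4 : A ^ 4 = (t ^ 3 - 2 * t) • A - (t ^ 2 - 1) • 1 := by
    rw [pow_succ, e3, sub_mul, smul_mul_assoc, hch, smul_mul_assoc, one_mul]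
    module
  have key : (t ^ 2 + t - 1) • A ^ 2 = 0 := by
    rw [← hphi, e4, e3, e2]
    module
  have hA : A ^ 2 ≠ 0 := by
    intro h
    have : A ^ 5 = A ^ 2 * A ^ 3 := by rw [← pow_add]
    rw [h5, h, zero_mul] at this
    exact one_ne_zero this
  exact aux_no_sqrt5 hdim hreal t ((smul_eq_zero.mp key).resolve_right hA)

lemma aux_primes {K : Type} [Field K] [Algebra ℚ K] (hdim : Module.finrank ℚ K = 2)
    (hreal : IsEmpty (K →+* ℝ)) (A : Matrix (Fin 2) (Fin 2) K) (p : ℕ) (hp : p.Prime)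
    (hA : A ^ p = 1) (h1 : A ≠ 1) : p = 2 ∨ p = 3 := by
  have h := aux_totient_le hdim A p 0 hp (by simpa using hA) (by simpa using h1)
  rw [zero_add, pow_one, Nat.totient_prime hp] at h
  have : p ≤ 5 := by omega
  have h5 : p ≠ 5 := by
    rintro rfl
    exact h1 (aux_no5 hdim hreal A hA)
  have := hp.two_le
  interval_cases p <;> simp_all +decide

lemma aux_exp3 {K : Type} [Field K] [Algebra ℚ K] (hdim : Module.finrank ℚ K = 2)
    (A : Matrix (Fin 2) (Fin 2) K) (k : ℕ) (hA : A ^ 3 ^ k = 1) : A ^ 3 = 1 := by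
  induction k with
  | zero => simp at hA; simp [hA]
  | succ k ih =>
    rcases k with _ | k
    · simpa using hA
    by_cases h : A ^ 3 ^ (k+1) = 1
    · exact ih h
    have := aux_totient_le hdim A 3 (k+1) Nat.prime_three hA h
    rw [Nat.totient_prime_pow_succ Nat.prime_three] at this
    have h3 : 3 ^ (k+1) ≥ 3 := by
      rw [pow_succ]; have := pow_pos (show 0 < 3 by norm_num) k; omega
    omega

lemma aux_trace3 {K : Type} [Field K] [CharZero K] (A : Matrix (Fin 2) (Fin 2) K)
    (hd : A.det = 1) (h3 : A ^ 3 = 1) (h1 : A ≠ 1) : A.trace = -1 := by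
  have hch := aux_ch A hd
  set t := A.trace with ht
  have e3 : A ^ 3 = (t ^ 2 - 1) • A - t • 1 := by
    rw [pow_succ, pow_two, hch, sub_mul, smul_mul_assoc, hch, one_mul]
    module
  rw [e3] at h3
  by_cases ht2 : t ^ 2 - 1 = 0
  · rw [ht2, zero_smul, zero_sub] at h3
    have := congrFun (congrFun h3 0) 0
    simp at this
    linear_combination -this
  · exfalso
    have hA : A = ((t + 1) / (t ^ 2 - 1)) • 1 := by
      have : (t ^ 2 - 1) • A = (t + 1) • 1 := by
        rw [sub_eq_iff_eq_add] at h3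
        rw [h3]; module
      rw [div_eq_inv_mul, mul_smul, ← this, smul_smul, inv_mul_cancel₀ ht2, one_smul]
    set c := (t + 1) / (t ^ 2 - 1)
    have htc : t = 2 * c := by
      rw [ht, hA]; simp [Matrix.trace]
    have hc2 : c ^ 2 = 1 := by
      rw [hA] at hd; simpa [Matrix.det_fin_two, pow_two] using hd
    have h00 := congrFun (congrFun h3 0) 0
    rw [hA] at h00
    simp at h00
    have : c = 1 := by
      rw [htc] at h00
      linear_combination h00 - (4 * c) * hc2
    apply h1
    rw [hA, this, one_smul]

lemma aux_comm3 {K : Type} [Field K] [CharZero K] (A B : Matrix (Fin 2) (Fin 2) K)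
    (hd : A.det = 1) (hdB : B.det = 1) (hA : A.trace = -1) (hB : B.trace = -1)
    (hc : A * B = B * A) : B = A ∨ B = A * A := by
  rw [Matrix.det_fin_two] at hd hdB
  rw [Matrix.trace_fin_two] at hA hB
  have c00 := congrFun (congrFun hc 0) 0
  have c01 := congrFun (congrFun hc 0) 1
  have c10 := congrFun (congrFun hc 1) 0
  simp only [Matrix.mul_apply, Fin.sum_univ_two] at c00 c01 c10
  have key : B = A ∨ B = -1 - A := by
    obtain ⟨a, b, c, d, rfl⟩ : ∃ a b c d, A = !![a, b; c, d] := ⟨_, _, _, _, Matrix.eta_fin_two A⟩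
    obtain ⟨x, y, z, w, rfl⟩ : ∃ x y z w, B = !![x, y; z, w] := ⟨_, _, _, _, Matrix.eta_fin_two B⟩
    simp at hd hdB hA hB c00 c01 c10
    obtain rfl : d = -1 - a := by linear_combination hA
    obtain rfl : w = -1 - x := by linear_combination hB
    have e1 : (2 * a + 1) * y = (2 * x + 1) * b := by linear_combination c01
    have e2 : (2 * a + 1) * z = (2 * x + 1) * c := by linear_combination -c10
    have e3 : b * z = y * c := by linear_combination c00
    have hs : x = a ∧ y = b ∧ z = c ∨ x = -1 - a ∧ y = -b ∧ z = -c := by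
      have hv : (x - a) * (x - (-1 - a)) = 0 := by
        have h12 : (12 : K) * ((x - a) * (x - (-1 - a))) = 0 := by
          linear_combination (-4 * (2 * x + 1) ^ 2) * hd + 4 * (2 * a + 1) ^ 2 * hdB
            + 4 * (2 * a + 1) * z * e1 + 4 * (2 * x + 1) * b * e2
        exact (mul_eq_zero.mp h12).resolve_left (by norm_num)
      by_cases hu : 2 * a + 1 = 0
      · have hxa : x = a := by
          rcases mul_eq_zero.mp hv with h | h
          · linear_combination h
          · linear_combination h - hu
        subst hxa
        have hbc : 4 * (b * c) = -3 := by linear_combination (-4) * hd - (2 * x + 1) * hu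
        have hyz : 4 * (y * z) = -3 := by linear_combination (-4) * hdB - (2 * x + 1) * hu
        have hb : b ≠ 0 := by rintro rfl; norm_num at hbc
        have hc0 : c ≠ 0 := by rintro rfl; norm_num at hbc
        have hyb : c * ((y - b) * (y + b)) = 0 := by
          linear_combination (-y) * e3 + b / 4 * hyz - b / 4 * hbc
        rcases mul_eq_zero.mp ((mul_eq_zero.mp hyb).resolve_left hc0) with h | h
        · obtain rfl : y = b := by linear_combination h
          exact Or.inl ⟨rfl, rfl, mul_left_cancel₀ hb e3⟩
        · obtain rfl : y = -b := by linear_combination h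
          exact Or.inr ⟨by linear_combination hu, rfl,
            mul_left_cancel₀ hb (by linear_combination e3)⟩
      · rcases mul_eq_zero.mp hv with h | h
        · left
          obtain rfl : x = a := by linear_combination h
          exact ⟨rfl, mul_left_cancel₀ hu e1, mul_left_cancel₀ hu e2⟩
        · right
          obtain rfl : x = -1 - a := by linear_combination h
          exact ⟨rfl, mul_left_cancel₀ hu (by linear_combination e1),
            mul_left_cancel₀ hu (by linear_combination e2)⟩
    rcases hs with ⟨rfl, rfl, rfl⟩ | ⟨rfl, rfl, rfl⟩
    · left; rfl
    · right
      ext i j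
      fin_cases i <;> fin_cases j <;> simp
  rcases key with h | h
  · exact Or.inl h
  · right
    rw [aux_ch A (by rw [Matrix.det_fin_two, hd]), Matrix.trace_fin_two, hA, h]
    module

lemma aux_card3 {K : Type} [Field K] [Algebra ℚ K] (hdim : Module.finrank ℚ K = 2)
    {P : Type} [Group P] [Finite P] (hP : IsPGroup 3 P)
    (f : P →* Matrix.GeneralLinearGroup (Fin 2) K) (hf : Function.Injective f)
    (hdet : ∀ g, (f g).val.det = 1) : Nat.card P ≤ 3 := by
  have : CharZero K := algebraRat.charZero K
  have : Fact (Nat.Prime 3) := ⟨Nat.prime_three⟩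
  rcases subsingleton_or_nontrivial P with hs | hn
  · have := Nat.card_of_subsingleton (1 : P)
    omega
  have h3 : ∀ g : P, g ≠ 1 → (f g).val.trace = -1 := by
    intro g hg
    obtain ⟨k, hk⟩ := hP g
    have hne : (f g).val ≠ 1 := fun h => hg (hf (by rw [map_one]; exact Units.ext h))
    have hpow : (f g).val ^ 3 ^ k = 1 := by
      rw [← Units.val_pow_eq_pow_val, ← map_pow, hk, map_one, Units.val_one]
    exact aux_trace3 _ (hdet g) (aux_exp3 hdim _ k hpow) hne
  have := hP.center_nontrivial
  obtain ⟨z, hz⟩ := exists_ne (1 : Subgroup.center P)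
  have hz1 : (z : P) ≠ 1 := fun h => hz (Subtype.ext h)
  have hall : ∀ g : P, g ∈ ({1, (z : P), (z : P) * z} : Set P) := by
    intro g
    by_cases hg : g = 1
    · simp [hg]
    have hc : (z : P) * g = g * z := (Subgroup.mem_center_iff.mp z.2 g).symm
    have hc' : (f z).val * (f g).val = (f g).val * (f z).val := by
      rw [← Units.val_mul, ← map_mul, hc, map_mul, Units.val_mul]
    rcases aux_comm3 _ _ (hdet z) (hdet g) (h3 z hz1) (h3 g hg) hc' with h | h
    · right; left
      exact hf (Units.ext h)
    · right; right
      apply hf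
      rw [map_mul]
      exact Units.ext h
  rw [← Set.ncard_univ, (Set.eq_univ_of_forall hall).symm]
  exact (Set.ncard_insert_le _ _).trans (by
    have h1 := Set.ncard_insert_le (z : P) {(z : P) * z}
    rw [Set.ncard_singleton] at h1
    omega)

lemma aux_card_form (n : ℕ) (hn : n ≠ 0) (h : ∀ p, p.Prime → p ∣ n → p = 2 ∨ p = 3) :
    ∃ a b, n = 2 ^ a * 3 ^ b := by
  obtain ⟨a, m, hm, rfl⟩ := Nat.exists_eq_pow_mul_and_not_dvd hn 2 (by norm_num)
  obtain ⟨b, l, hl, rfl⟩ := Nat.exists_eq_pow_mul_and_not_dvd (n := m) (by rintro rfl; simp at hm) 3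
    (by norm_num)
  refine ⟨a, b, ?_⟩
  have : l = 1 := by
    by_contra hne
    obtain ⟨p, hp, hpl⟩ := Nat.exists_prime_and_dvd hne
    rcases h p hp ((hpl.mul_left _).mul_left _) with rfl | rfl
    · exact hm (hpl.mul_left _)
    · exact hl hpl
  simp [this]

lemma aux_perm_solvable (X : Type) [Finite X] (h : Nat.card X ≤ 3) :
    Group.IsSolvable (Equiv.Perm X) := by
  classical
  have := Fintype.ofFinite X
  rw [Nat.card_eq_fintype_card] at h
  have : Group.IsSolvable (alternatingGroup X) := by
    rcases subsingleton_or_nontrivial X with hs | hn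
    · infer_instance
    have hc := nat_card_alternatingGroup (α := X)
    rw [Nat.card_eq_fintype_card (α := X)] at hc
    have h2 := Fintype.one_lt_card_iff_nontrivial.mpr hn
    generalize Fintype.card X = n at *
    interval_cases n
    · have : Subsingleton (alternatingGroup X) :=
        (Nat.card_eq_one_iff_unique.mp (by simpa using hc)).1
      infer_instance
    · have : Fact (Nat.Prime 3) := ⟨Nat.prime_three⟩
      have hcyc : IsCyclic (alternatingGroup X) :=
        isCyclic_of_prime_card (p := 3) (by rw [hc]; decide)
      have := hcyc.isMulCommutative
      exact Group.isSolvable_of_comm (fun a b => mul_comm' a b)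
  exact Group.isSolvable_of_ker_le_range (alternatingGroup X).subtype Equiv.Perm.sign
    (by rw [Subgroup.range_subtype]; exact le_refl _)

lemma aux_solvable_23 (H : Type) [Group H] [Finite H] (a b : ℕ)
    (hc : Nat.card H = 2 ^ a * 3 ^ b) (hb : ∀ P : Sylow 3 H, Nat.card P ≤ 3) :
    Group.IsSolvable H := by
  have : Fact (Nat.Prime 2) := ⟨Nat.prime_two⟩
  have : Fact (Nat.Prime 3) := ⟨Nat.prime_three⟩
  have hb' : 3 ^ b ≤ 3 := by
    obtain ⟨P⟩ : Nonempty (Sylow 3 H) := inferInstance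
    have h1 : 3 ^ b ∣ Nat.card P := P.pow_dvd_card_of_pow_dvd_card (by rw [hc]; exact dvd_mul_left _ _)
    exact (Nat.le_of_dvd Nat.card_pos h1).trans (hb P)
  obtain ⟨Q⟩ : Nonempty (Sylow 2 H) := inferInstance
  have hQ : 2 ^ a ∣ Nat.card Q := Q.pow_dvd_card_of_pow_dvd_card (by rw [hc]; exact dvd_mul_right _ _)
  have hi : (Q : Subgroup H).index ≤ 3 := by
    have h1 := (Q : Subgroup H).card_mul_index
    rw [hc] at h1
    obtain ⟨c, hcc⟩ := hQ
    have hcc' : Nat.card (Q : Subgroup H) = 2 ^ a * c := hcc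
    rw [hcc', mul_assoc] at h1
    have h2 := Nat.eq_of_mul_eq_mul_left (pow_pos (by norm_num) a) h1
    refine (Nat.le_of_dvd (by positivity) (Dvd.intro_left c h2)).trans hb'
  have hsol := aux_perm_solvable (H ⧸ (Q : Subgroup H)) hi
  have hnil : Group.IsSolvable (Q : Subgroup H) := by
    have := Q.isPGroup'.isNilpotent
    infer_instance
  refine Group.isSolvable_of_ker_le_range (Q : Subgroup H).subtype
    (MulAction.toPermHom H (H ⧸ (Q : Subgroup H))) ?_
  rw [← Subgroup.normalCore_eq_ker, Subgroup.range_subtype]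
  exact Subgroup.normalCore_le _

theorem finite_subgroup_GL2_imaginary_quadratic_solvable
    (K : Type) [Field K] [Algebra ℚ K] (hdim : Module.finrank ℚ K = 2)
    (hreal : IsEmpty (K →+* ℝ))
    (G : Subgroup (Matrix.GeneralLinearGroup (Fin 2) K)) (hG : Finite G) :
    IsSolvable G ∧ ∃ m n : ℕ, Nat.card G = 2 ^ m * 3 ^ n := by
  have hcard : ∀ p, p.Prime → p ∣ Nat.card G → p = 2 ∨ p = 3 := by
    intro p hp hpd
    have := Fact.mk hp
    obtain ⟨g, hg⟩ := exists_prime_orderOf_dvd_card' p hpd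
    apply aux_primes hdim hreal g.1.val p hp
    · rw [← hg, ← Units.val_pow_eq_pow_val, ← Subgroup.coe_pow, pow_orderOf_eq_one]; rfl
    · intro h
      have : g = 1 := Subtype.ext (Units.ext h)
      rw [this, orderOf_one] at hg
      exact hp.one_lt.ne hg
  refine ⟨?_, aux_card_form _ Nat.card_pos.ne' hcard⟩
  let d : G →* Kˣ := Matrix.GeneralLinearGroup.det.comp G.subtype
  have hker : Group.IsSolvable d.ker := by
    obtain ⟨a, b, hab⟩ := aux_card_form (Nat.card d.ker) Nat.card_pos.ne'
      (fun p hp hpd => hcard p hp (hpd.trans (Subgroup.card_subgroup_dvd_card _)))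
    refine aux_solvable_23 _ a b hab fun P => ?_
    refine aux_card3 hdim P.isPGroup' ((G.subtype.comp d.ker.subtype).comp
      (P : Subgroup d.ker).subtype) ?_ ?_
    · exact (G.subtype_injective.comp d.ker.subtype_injective).comp
        (P : Subgroup d.ker).subtype_injective
    · intro g
      have := g.1.2
      exact congrArg Units.val (MonoidHom.mem_ker.mp this)
  exact Group.isSolvable_of_ker_le_range d.ker.subtype d (by simp)
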